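/- Let [a,b] ⊆ (0,1] with u_h(γ) ≥ κ_S for all γ ∈ [a,b], suppose there is an index p such that u_h(γ) = γR_p − c_p for all γ ∈ [a,b], and let κ_I ≥ 0. Then the principal's utility γ ↦ (1−γ)R_p − β(γ)·κ_I is a concave function on [a,b]. -/

import Mathlib

/-- The upper envelope function `u_h(γ) = max_j (γ R_j - c_j)`. -/
noncomputable def uh (n : ℕ) (hn : 0 < n) (R c : Fin n → ℝ) (γ : ℝ) : ℝ :=
  Finset.univ.sup' (Finset.univ_nonempty_iff.mpr (Fin.pos_iff_nonempty.mp hn))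
    (fun j => γ * R j - c j)

/-- The inspection threshold `β(γ) = max{1 - δ(γ)/(γ(1-α)), 0}`. -/
noncomputable def betaFn (α : ℝ) (δ : ℝ → ℝ) (γ : ℝ) : ℝ :=
  max (1 - δ γ / (γ * (1 - α))) 0

theorem le_uh {n : ℕ} (hn : 0 < n) (R c : Fin n → ℝ) (γ : ℝ) (j : Fin n) :
    γ * R j - c j ≤ uh n hn R c γ :=
  Finset.le_sup' (fun j => γ * R j - c j) (Finset.mem_univ j)

theorem exists_uh_eq {n : ℕ} (hn : 0 < n) (R c : Fin n → ℝ) (γ : ℝ) :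
    ∃ j, uh n hn R c γ = γ * R j - c j := by
  obtain ⟨j, -, hj⟩ := Finset.exists_mem_eq_sup'
    (Finset.univ_nonempty_iff.mpr (Fin.pos_iff_nonempty.mp hn)) (fun j => γ * R j - c j)
  exact ⟨j, hj⟩

/-- An action attaining the envelope at `x` has index at most that of an action attaining it at
some `y ≥ x` where the envelope is strictly larger. -/
theorem le_of_uh_eq {n : ℕ} (hn : 0 < n) {R c : Fin n → ℝ} (hR : StrictMono R) {x y : ℝ}
    (hxy : x ≤ y) {j p : Fin n} (hj : uh n hn R c x = x * R j - c j)
    (hp : uh n hn R c y = y * R p - c p) (hlt : uh n hn R c x < uh n hn R c y) : j ≤ p := by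
  by_contra! h
  have hne : x ≠ y := by
    rintro rfl
    exact lt_irrefl _ hlt
  have h₁ := le_uh hn R c x p
  have h₂ := le_uh hn R c y j
  nlinarith [mul_pos (sub_pos.2 (lt_of_le_of_ne hxy hne)) (sub_pos.2 (hR h))]

/-- A function on a set of positive reals that is everywhere at most each `A i + B i * x⁻¹` and
at every point equal to one with `B i ≤ 0` is concave. -/
theorem concaveOn_of_le_add_mul_inv {ι : Type*} {s : Set ℝ} (hs : Convex ℝ s)
    (hpos : ∀ x ∈ s, 0 < x) (A B : ι → ℝ) (f : ℝ → ℝ)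
    (hle : ∀ x ∈ s, ∀ i, f x ≤ A i + B i * x⁻¹)
    (heq : ∀ x ∈ s, ∃ i, B i ≤ 0 ∧ f x = A i + B i * x⁻¹) : ConcaveOn ℝ s f := by
  refine ⟨hs, fun x hx y hy t r ht hr htr => ?_⟩
  obtain ⟨i, hB, hi⟩ := heq _ (hs hx hy ht hr htr)
  have hinv : (t • x + r • y)⁻¹ ≤ t • x⁻¹ + r • y⁻¹ := by
    have := (convexOn_zpow (𝕜 := ℝ) (-1)).2 (hpos x hx) (hpos y hy) ht hr htr
    simpa only [zpow_neg_one] using this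
  rw [hi]
  simp only [smul_eq_mul] at hinv ⊢
  have hA : A i = t * A i + r * A i := by rw [← add_mul, htr, one_mul]
  nlinarith [mul_le_mul_of_nonneg_left (hle x hx i) ht,
    mul_le_mul_of_nonneg_left (hle y hy i) hr, mul_le_mul_of_nonpos_left hinv hB]

/-- on a segment `[a,b] ⊆ (0,1]` where `u_h` is affine (given by
action `p`), the principal's utility `γ ↦ (1-γ) R_p - β(γ) κ_I` is concave. -/
theorem principal_utility_concave
    (n : ℕ) (hn : 0 < n) (R c : Fin n → ℝ)
    (hc0 : 0 ≤ c ⟨0, hn⟩) (hc : StrictMono c)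
    (hR0 : 0 < R ⟨0, hn⟩) (hR : StrictMono R)
    (κS : ℝ) (hκS : 0 < κS) (α : ℝ) (hα0 : 0 < α) (hα1 : α < 1)
    (δ : ℝ → ℝ)
    (hδ : ∀ γ ∈ Set.Ioc (0 : ℝ) 1, κS ≤ uh n hn R c γ →
      δ γ ∈ Set.Icc 0 γ ∧ uh n hn R c (δ γ) = uh n hn R c γ - κS)
    (a b : ℝ) (ha : 0 < a) (hb : b ≤ 1)
    (hκ : ∀ γ ∈ Set.Icc a b, κS ≤ uh n hn R c γ)
    (p : Fin n)
    (hp : ∀ γ ∈ Set.Icc a b, uh n hn R c γ = γ * R p - c p)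
    (κI : ℝ) (hκI : 0 ≤ κI) :
    ConcaveOn ℝ (Set.Icc a b) (fun γ => (1 - γ) * R p - betaFn α δ γ * κI) := by
  have hRpos : ∀ j, 0 < R j := fun j =>
    hR0.trans_le (hR.monotone (Fin.mk_le_of_le_val (Nat.zero_le _)))
  have hpos : ∀ γ ∈ Set.Icc a b, 0 < γ := fun γ hγ => ha.trans_le hγ.1
  have hδ' : ∀ γ ∈ Set.Icc a b, δ γ ≤ γ ∧ uh n hn R c (δ γ) = γ * R p - c p - κS := by
    intro γ hγ
    obtain ⟨h₁, h₂⟩ := hδ γ ⟨hpos γ hγ, hγ.2.trans hb⟩ (hκ γ hγ)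
    exact ⟨h₁.2, by rw [h₂, hp γ hγ]⟩
  have hrw : ∀ γ ∈ Set.Icc a b, ∀ j,
      R p / R j + (c j - c p - κS) / R j * γ⁻¹ = (γ * R p - c p - κS + c j) / R j / γ := by
    intro γ hγ j
    have := (hpos γ hγ).ne'
    have := (hRpos j).ne'
    field_simp
    ring
  have hconc : ConcaveOn ℝ (Set.Icc a b) (fun γ => δ γ / γ) := by
    refine concaveOn_of_le_add_mul_inv (convex_Icc a b) hpos (fun j => R p / R j)
      (fun j => (c j - c p - κS) / R j) _ (fun γ hγ j => ?_) (fun γ hγ => ?_)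
    · rw [hrw γ hγ j]
      refine div_le_div_of_nonneg_right ?_ (hpos γ hγ).le
      rw [le_div_iff₀ (hRpos j)]
      linarith [le_uh hn R c (δ γ) j, (hδ' γ hγ).2]
    · obtain ⟨j, hj⟩ := exists_uh_eq hn R c (δ γ)
      obtain ⟨hle, heq⟩ := hδ' γ hγ
      have hjp : j ≤ p :=
        le_of_uh_eq hn hR hle hj (hp γ hγ) (by rw [heq, hp γ hγ]; linarith)
      refine ⟨j, div_nonpos_of_nonpos_of_nonneg ?_ (hRpos j).le, ?_⟩
      · linarith [hc.monotone hjp]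
      · rw [hrw γ hγ j]
        congr 1
        rw [eq_div_iff (hRpos j).ne']
        linarith
  have hβ : ConvexOn ℝ (Set.Icc a b) (betaFn α δ) := by
    have h := ((convexOn_const (1 : ℝ) (convex_Icc a b)).sub
      (hconc.smul (inv_nonneg.2 (sub_nonneg.2 hα1.le)))).sup
      (convexOn_const (0 : ℝ) (convex_Icc a b))
    refine h.congr fun γ _ => ?_
    simp only [betaFn, Pi.sup_apply, Pi.sub_apply, smul_eq_mul]
    rw [← div_div, div_eq_inv_mul (δ γ / γ)]
  refine ⟨convex_Icc a b, fun x hx y hy t r ht hr htr => ?_⟩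
  have h := mul_le_mul_of_nonneg_right (hβ.2 hx hy ht hr htr) hκI
  simp only [smul_eq_mul] at h ⊢
  obtain rfl : t = 1 - r := by linarith
  linarith
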